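/- Let β ∈ {ξ, ν, μ, η}, fix an integer r ≥ 2, and let t = t(r) = ⌈√(2r + 1/4) − 1/2⌉. Then liminf_{n→∞} NGΠ↑_β(r;n)/n^r ≥ t^{−r} and limsup_{n→∞} NGΠ↑_β(r;n)/n^r ≤ r^{−r/2}. -/

import Mathlib

open scoped Classical

namespace NG

/-- The set of earlier neighbors (back-neighborhood) of vertex `j` in `H`,
with respect to the natural order on `Fin N`. -/
noncomputable def backNbhd {N : ℕ} (H : SimpleGraph (Fin N)) (j : Fin N) :
    Finset (Fin N) :=
  Finset.univ.filter (fun i => (i : ℕ) < (j : ℕ) ∧ H.Adj i j)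

/-- The degree of `u` in the subgraph of `H` induced on the first `j` vertices
(the "stage `j`" graph of the construction). -/
noncomputable def stageDeg {N : ℕ} (H : SimpleGraph (Fin N)) (j : ℕ) (u : Fin N) : ℕ :=
  (Finset.univ.filter (fun w : Fin N => (w : ℕ) < j ∧ (u : ℕ) < j ∧ H.Adj u w)).card

/-- `H` on `Fin N` is a `k`-tree, built in the natural vertex order: the first
`k+1` vertices form a clique, and every later vertex is joined exactly to the
vertices of an existing `k`-clique. -/
def IsKTreeOrd (k : ℕ) (N : ℕ) (H : SimpleGraph (Fin N)) : Prop :=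
  1 ≤ k ∧ k + 1 ≤ N ∧
  (∀ i j : Fin N, (i : ℕ) < (j : ℕ) → (j : ℕ) ≤ k → H.Adj i j) ∧
  (∀ j : Fin N, k < (j : ℕ) →
    (backNbhd H j).card = k ∧ H.IsClique (backNbhd H j : Set (Fin N)))

/-- A linear `k`-tree: a `k`-tree in which each new vertex (after the first added
one) is joined to a `k`-clique containing the vertex added at the previous step. -/
def IsLinearKTreeOrd (k : ℕ) (N : ℕ) (H : SimpleGraph (Fin N)) : Prop :=
  IsKTreeOrd k N H ∧
  ∀ i j : Fin N, (i : ℕ) + 1 = (j : ℕ) → k + 1 < (j : ℕ) → i ∈ backNbhd H j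

/-- A `k`-caterpillar: a `k`-tree in which each new vertex (after the first added
one) is joined to a `k`-clique contained in the maximal `(k+1)`-clique created at
the previous stage. -/
def IsCaterpillarOrd (k : ℕ) (N : ℕ) (H : SimpleGraph (Fin N)) : Prop :=
  IsKTreeOrd k N H ∧
  ∀ i j : Fin N, (i : ℕ) + 1 = (j : ℕ) → k + 1 < (j : ℕ) →
    backNbhd H j ⊆ insert i (backNbhd H i)

/-- A two-sided `k`-tree: a `k`-tree in which each new vertex is joined to a
`k`-clique that either contains a vertex of degree `k` (at that stage) or equals
the `k`-clique to which some previously added vertex was joined. -/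
def IsTwoSidedKTreeOrd (k : ℕ) (N : ℕ) (H : SimpleGraph (Fin N)) : Prop :=
  IsKTreeOrd k N H ∧
  ∀ j : Fin N, k < (j : ℕ) →
    ((∃ u ∈ backNbhd H j, stageDeg H (j : ℕ) u = k) ∨
     (∃ i : Fin N, k < (i : ℕ) ∧ (i : ℕ) < (j : ℕ) ∧ backNbhd H i = backNbhd H j))

/-- The least `k` such that `G` embeds as a subgraph into some graph in the
class `P k`; an edgeless graph gets the value `0`. -/
noncomputable def widthParam (P : ℕ → (N : ℕ) → SimpleGraph (Fin N) → Prop)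
    (n : ℕ) (G : SimpleGraph (Fin n)) : ℕ :=
  if G = ⊥ then 0
  else sInf {k | ∃ (N : ℕ) (H : SimpleGraph (Fin N)) (f : Fin n ↪ Fin N),
    P k N H ∧ ∀ u v : Fin n, G.Adj u v → H.Adj (f u) (f v)}

/-- Tree-width: the least `k` such that `G` is a subgraph of a `k`-tree. -/
noncomputable def treewidth (n : ℕ) (G : SimpleGraph (Fin n)) : ℕ :=
  widthParam IsKTreeOrd n G

/-- Largeur d'arborescence: the least `k` such that `G` is a subgraph of a
two-sided `k`-tree. -/
noncomputable def la (n : ℕ) (G : SimpleGraph (Fin n)) : ℕ :=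
  widthParam IsTwoSidedKTreeOrd n G

/-- Path-width: the least `k` such that `G` is a subgraph of a `k`-caterpillar. -/
noncomputable def pw (n : ℕ) (G : SimpleGraph (Fin n)) : ℕ :=
  widthParam IsCaterpillarOrd n G

/-- Proper path-width: the least `k` such that `G` is a subgraph of a linear
`k`-tree. -/
noncomputable def ppw (n : ℕ) (G : SimpleGraph (Fin n)) : ℕ :=
  widthParam IsLinearKTreeOrd n G

/-- `G` has a complete-graph minor on `m` branch sets: there are `m` pairwise
disjoint nonempty connected vertex sets with an edge between every two of them. -/
def HasCliqueMinor {n : ℕ} (G : SimpleGraph (Fin n)) (m : ℕ) : Prop :=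
  ∃ B : Fin m → Finset (Fin n),
    (∀ p, (B p).Nonempty) ∧
    (∀ p, (G.induce ((B p : Finset (Fin n)) : Set (Fin n))).Connected) ∧
    (∀ p q, p ≠ q → Disjoint (B p) (B q)) ∧
    (∀ p q, p ≠ q → ∃ u ∈ B p, ∃ v ∈ B q, G.Adj u v)

/-- The Hadwiger number: the largest `m` such that `K_m` is a minor of `G`. -/
noncomputable def hadwiger (n : ℕ) (G : SimpleGraph (Fin n)) : ℕ :=
  sSup {m | HasCliqueMinor G m}

/-- `A` is a symmetric matrix whose off-diagonal nonzero pattern is the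
adjacency of `G`. -/
def DescribesGraph {n : ℕ} (A : Matrix (Fin n) (Fin n) ℝ)
    (G : SimpleGraph (Fin n)) : Prop :=
  A.IsSymm ∧ ∀ i j : Fin n, i ≠ j → (A i j ≠ 0 ↔ G.Adj i j)

/-- The Strong Arnold Property: the only symmetric `X` with `AX = O`,
`A∘X = O` and `I∘X = O` is `X = O`. -/
def StrongArnold {n : ℕ} (A : Matrix (Fin n) (Fin n) ℝ) : Prop :=
  ∀ X : Matrix (Fin n) (Fin n) ℝ, X.IsSymm → A * X = 0 →
    (∀ i j, A i j * X i j = 0) → (∀ i, X i i = 0) → X = 0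

/-- The nullity of a square real matrix. -/
noncomputable def nullity {n : ℕ} (A : Matrix (Fin n) (Fin n) ℝ) : ℕ :=
  Module.finrank ℝ (LinearMap.ker (Matrix.toLin' A))

/-- The Colin de Verdière type parameter `ξ`: maximum nullity of a matrix in
`S(G)` with the Strong Arnold Property. -/
noncomputable def xiParam (n : ℕ) (G : SimpleGraph (Fin n)) : ℕ :=
  sSup {m | ∃ A : Matrix (Fin n) (Fin n) ℝ,
    DescribesGraph A G ∧ StrongArnold A ∧ nullity A = m}

/-- The Colin de Verdière type parameter `ν`: maximum nullity of a positive
semidefinite matrix in `S(G)` with the Strong Arnold Property. -/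
noncomputable def nuParam (n : ℕ) (G : SimpleGraph (Fin n)) : ℕ :=
  sSup {m | ∃ A : Matrix (Fin n) (Fin n) ℝ,
    DescribesGraph A G ∧ A.PosSemidef ∧ StrongArnold A ∧ nullity A = m}

/-- The Colin de Verdière number `μ`: maximum nullity of a generalized
Laplacian in `S(G)` with exactly one negative eigenvalue and the Strong Arnold
Property. -/
noncomputable def muParam (n : ℕ) (G : SimpleGraph (Fin n)) : ℕ :=
  sSup {m | ∃ (A : Matrix (Fin n) (Fin n) ℝ) (hA : A.IsHermitian),
    DescribesGraph A G ∧ StrongArnold A ∧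
    (Finset.univ.filter (fun i => hA.eigenvalues i < 0)).card = 1 ∧
    (∀ i j : Fin n, i ≠ j → A i j ≤ 0) ∧ nullity A = m}

/-- An `r`-decomposition of `K_n`: spanning subgraphs with pairwise disjoint
edge sets whose union is all of `K_n`. -/
def IsDecomp {n r : ℕ} (G : Fin r → SimpleGraph (Fin n)) : Prop :=
  (∀ i j : Fin r, i ≠ j → Disjoint (G i) (G j)) ∧ (⨆ i, G i) = ⊤

/-- A non-degenerate `r`-decomposition: every part has at least one edge. -/
def IsNDDecomp {n r : ℕ} (G : Fin r → SimpleGraph (Fin n)) : Prop :=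
  IsDecomp G ∧ ∀ i, G i ≠ ⊥

/-- Nordhaus–Gaddum sum upper bound `NGΣ↑_β(r;n)`. -/
noncomputable def NGsumUp {n : ℕ} (β : SimpleGraph (Fin n) → ℕ) (r : ℕ) : ℕ :=
  sSup {s | ∃ G : Fin r → SimpleGraph (Fin n), IsDecomp G ∧ ∑ i, β (G i) = s}

/-- Nordhaus–Gaddum sum lower bound `NGΣ↓_β(r;n)`. -/
noncomputable def NGsumLow {n : ℕ} (β : SimpleGraph (Fin n) → ℕ) (r : ℕ) : ℕ :=
  sInf {s | ∃ G : Fin r → SimpleGraph (Fin n), IsDecomp G ∧ ∑ i, β (G i) = s}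

/-- Non-degenerate Nordhaus–Gaddum sum lower bound `NGΣ↓ⁿ_β(r;n)`. -/
noncomputable def NGsumLowND {n : ℕ} (β : SimpleGraph (Fin n) → ℕ) (r : ℕ) : ℕ :=
  sInf {s | ∃ G : Fin r → SimpleGraph (Fin n), IsNDDecomp G ∧ ∑ i, β (G i) = s}

/-- Nordhaus–Gaddum product upper bound `NGΠ↑_β(r;n)`. -/
noncomputable def NGprodUp {n : ℕ} (β : SimpleGraph (Fin n) → ℕ) (r : ℕ) : ℕ :=
  sSup {s | ∃ G : Fin r → SimpleGraph (Fin n), IsDecomp G ∧ ∏ i, β (G i) = s}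

/-- Non-degenerate Nordhaus–Gaddum product upper bound `NGΠ↑ⁿ_β(r;n)`. -/
noncomputable def NGprodUpND {n : ℕ} (β : SimpleGraph (Fin n) → ℕ) (r : ℕ) : ℕ :=
  sSup {s | ∃ G : Fin r → SimpleGraph (Fin n), IsNDDecomp G ∧ ∏ i, β (G i) = s}

/-- Nordhaus–Gaddum product lower bound `NGΠ↓_β(r;n)`. -/
noncomputable def NGprodLow {n : ℕ} (β : SimpleGraph (Fin n) → ℕ) (r : ℕ) : ℕ :=
  sInf {s | ∃ G : Fin r → SimpleGraph (Fin n), IsDecomp G ∧ ∏ i, β (G i) = s}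

/-- Non-degenerate Nordhaus–Gaddum product lower bound `NGΠ↓ⁿ_β(r;n)`. -/
noncomputable def NGprodLowND {n : ℕ} (β : SimpleGraph (Fin n) → ℕ) (r : ℕ) : ℕ :=
  sInf {s | ∃ G : Fin r → SimpleGraph (Fin n), IsNDDecomp G ∧ ∏ i, β (G i) = s}

/-- The triangular root `t(r) = ⌈√(2r + 1/4) − 1/2⌉`. -/
noncomputable def trt (r : ℕ) : ℕ := ⌈Real.sqrt (2 * (r : ℝ) + 1 / 4) - 1 / 2⌉₊

/-- `H` is a path together with isolated vertices: its edges are exactly those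
of a path through some list of distinct vertices. -/
def IsPathGraph {n : ℕ} (H : SimpleGraph (Fin n)) : Prop :=
  ∃ (m : ℕ) (f : Fin (m + 1) ↪ Fin n), ∀ u v : Fin n,
    H.Adj u v ↔ ∃ a b : Fin (m + 1), (a : ℕ) + 1 = (b : ℕ) ∧
      ((u = f a ∧ v = f b) ∨ (u = f b ∧ v = f a))

end NG

namespace NG

/-- number of edges -/
noncomputable def ec {n : ℕ} (G : SimpleGraph (Fin n)) : ℕ :=
  (Finset.univ.filter (fun e : Sym2 (Fin n) => e ∈ G.edgeSet)).card

/-- diagonal pairs and edges -/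
noncomputable def TT {n : ℕ} (G : SimpleGraph (Fin n)) : Finset (Sym2 (Fin n)) :=
  Finset.univ.filter (fun e : Sym2 (Fin n) => e.IsDiag ∨ e ∈ G.edgeSet)

lemma card_TT {n : ℕ} (G : SimpleGraph (Fin n)) : (TT G).card ≤ n + ec G := by
  unfold TT ec
  rw [Finset.filter_or]
  refine (Finset.card_union_le _ _).trans ?_
  gcongr
  have : (Finset.univ.filter (fun e : Sym2 (Fin n) => e.IsDiag)) ⊆
      Finset.univ.image (fun i : Fin n => s(i, i)) := by
    intro e he
    induction e with
    | _ i j =>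
      simp at he
      simp [he]
  refine (Finset.card_le_card this).trans (Finset.card_image_le.trans ?_)
  simp

lemma sap_bound {n : ℕ} {G : SimpleGraph (Fin n)} {A : Matrix (Fin n) (Fin n) ℝ}
    (hA : DescribesGraph A G) (hS : StrongArnold A) :
    (nullity A + 1).choose 2 ≤ n + ec G := by
  refine le_trans ?_ (card_TT G)
  set m := nullity A with hm
  let b : Module.Basis (Fin m) ℝ (LinearMap.ker (Matrix.toLin' A)) := Module.finBasis ℝ _
  let U : Fin m → Fin n → ℝ := fun p => (b p : Fin n → ℝ)
  have hU : LinearIndependent ℝ U :=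
    b.linearIndependent.map' (Submodule.subtype _) (Submodule.ker_subtype _)
  have hAU : ∀ p i, ∑ k, A i k * U p k = 0 := by
    intro p i
    have h := (b p).2
    rw [LinearMap.mem_ker, Matrix.toLin'_apply] at h
    exact congrFun h i
  let X : (Sym2 (Fin m) → ℝ) → Matrix (Fin n) (Fin n) ℝ :=
    fun y i j => ∑ p, ∑ q, U p i * U q j * y s(p, q)
  have Xsymm : ∀ y i j, X y i j = X y j i := by
    intro y i j
    simp only [X]
    rw [Finset.sum_comm]
    refine Finset.sum_congr rfl fun p _ => Finset.sum_congr rfl fun q _ => ?_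
    rw [Sym2.eq_swap]; ring
  let L : (Sym2 (Fin m) → ℝ) →ₗ[ℝ] (TT G → ℝ) :=
    { toFun := fun y e => X y (Quot.out e.1).1 (Quot.out e.1).2
      map_add' := by
        intro y z; ext e
        simp only [X, Pi.add_apply, mul_add, Finset.sum_add_distrib]
      map_smul' := by
        intro c y; ext e
        simp only [X, Pi.smul_apply, smul_eq_mul, Finset.mul_sum, RingHom.id_apply]
        refine Finset.sum_congr rfl fun p _ => Finset.sum_congr rfl fun q _ => ?_
        ring }
  have hL : Function.Injective L := by
    rw [← LinearMap.ker_eq_bot, LinearMap.ker_eq_bot']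
    intro y hy
    have key : ∀ i j, s(i, j) ∈ TT G → X y i j = 0 := by
      intro i j h
      have h1 : X y (Quot.out s(i,j)).1 (Quot.out s(i,j)).2 = 0 := congrFun hy ⟨s(i, j), h⟩
      have h2 : s((Quot.out s(i,j)).1, (Quot.out s(i,j)).2) = s(i,j) := Quot.out_eq _
      rw [Sym2.eq_iff] at h2
      rcases h2 with ⟨h3, h4⟩ | ⟨h3, h4⟩
      · rwa [h3, h4] at h1
      · rw [h3, h4] at h1
        rw [Xsymm]; exact h1
    have hX : X y = 0 := by
      apply hS
      · ext i j; exact Xsymm y j i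
      · ext i j
        rw [Matrix.mul_apply, Matrix.zero_apply]
        simp only [X, Finset.mul_sum]
        rw [Finset.sum_comm]
        refine Finset.sum_eq_zero fun p _ => ?_
        rw [Finset.sum_comm]
        refine Finset.sum_eq_zero fun q _ => ?_
        have : ∀ k, A i k * (U p k * U q j * y s(p, q)) =
          (A i k * U p k) * (U q j * y s(p,q)) := fun k => by ring
        simp only [this, ← Finset.sum_mul, hAU, zero_mul]
      · intro i j
        by_cases hij : i = j
        · subst hij
          rw [key i i (by simp [TT]), mul_zero]
        · by_cases h0 : A i j = 0
          · rw [h0, zero_mul]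
          · have := (hA.2 i j hij).1 h0
            rw [key i j (by simp [TT, this]), mul_zero]
      · intro i
        exact key i i (by simp [TT])
    rw [Fintype.linearIndependent_iff] at hU
    have h1 : ∀ p j, ∑ q, y s(p, q) * U q j = 0 := by
      intro p j
      refine hU (fun p => ∑ q, y s(p, q) * U q j) ?_ p
      ext i
      have := congrFun (congrFun hX i) j
      simp only [X, Matrix.zero_apply] at this
      simp only [Finset.sum_apply, Pi.smul_apply, smul_eq_mul, Pi.zero_apply]
      rw [← this]
      refine Finset.sum_congr rfl fun p _ => ?_
      rw [Finset.sum_mul]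
      refine Finset.sum_congr rfl fun q _ => ?_
      ring
    ext e
    induction e with
    | _ p q =>
      refine hU (fun q => y s(p, q)) ?_ q
      ext j
      simpa using h1 p j
  have := LinearMap.finrank_le_finrank_of_injective hL
  simpa [Sym2.card] using this

lemma minor_bound {n : ℕ} {G : SimpleGraph (Fin n)} {m : ℕ} (h : HasCliqueMinor G m) :
    (m + 1).choose 2 ≤ n + ec G := by
  refine le_trans ?_ (card_TT G)
  obtain ⟨B, hne, -, hdis, hadj⟩ := h
  rcases Nat.eq_zero_or_pos m with rfl | hm
  · simp
  let L : Fin n → Fin m := fun u => if h : ∃ p, u ∈ B p then h.choose else ⟨0, hm⟩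
  have hLp : ∀ p u, u ∈ B p → L u = p := by
    intro p u hu
    have h : ∃ p, u ∈ B p := ⟨p, hu⟩
    have h1 : L u = h.choose := dif_pos h
    rw [h1]
    by_contra hc
    exact (Finset.disjoint_left.1 (hdis _ _ hc) h.choose_spec) hu
  have : (Finset.univ : Finset (Sym2 (Fin m))).card ≤ (TT G).card := by
    apply Finset.card_le_card_of_surjOn (Sym2.map L)
    intro e _
    induction e with
    | _ p q =>
      by_cases hpq : p = q
      · subst hpq
        obtain ⟨u, hu⟩ := hne p
        exact ⟨s(u, u), by simp [TT], by simp [hLp p u hu]⟩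
      · obtain ⟨u, hu, v, hv, huv⟩ := hadj p q hpq
        exact ⟨s(u, v), by simp [TT, huv], by simp [hLp p u hu, hLp q v hv]⟩
  simpa [Sym2.card] using this

lemma minor_le {n : ℕ} {G : SimpleGraph (Fin n)} {m : ℕ} (h : HasCliqueMinor G m) : m ≤ n := by
  obtain ⟨B, hne, -, hdis, hadj⟩ := h
  choose f hf using hne
  have : Function.Injective f := by
    intro p q hpq
    by_contra hc
    exact Finset.disjoint_left.1 (hdis p q hc) (hf p) (hpq ▸ hf q)
  simpa using Fintype.card_le_of_injective f this

lemma nullity_le {n : ℕ} (A : Matrix (Fin n) (Fin n) ℝ) : nullity A ≤ n := by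
  unfold nullity
  simpa using Submodule.finrank_le (LinearMap.ker (Matrix.toLin' A))

lemma sSup_prop (S : Set ℕ) (n : ℕ) (hb : ∀ m ∈ S, m ≤ n) (P : ℕ → Prop) (h0 : P 0)
    (h : ∀ m ∈ S, P m) : P (sSup S) := by
  rcases S.eq_empty_or_nonempty with rfl | hS
  · simpa using h0
  · exact h _ (Nat.sSup_mem hS ⟨n, hb⟩)

lemma upper_bound (β : (n : ℕ) → SimpleGraph (Fin n) → ℕ)
    (hβ : β = NG.xiParam ∨ β = NG.nuParam ∨ β = NG.muParam ∨ β = NG.hadwiger)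
    (n : ℕ) (G : SimpleGraph (Fin n)) : (β n G + 1).choose 2 ≤ n + ec G := by
  rcases hβ with rfl | rfl | rfl | rfl
  · refine sSup_prop _ n ?_ (fun m => (m + 1).choose 2 ≤ n + ec G) (by simp) ?_
    · rintro m ⟨A, -, -, rfl⟩; exact nullity_le A
    · rintro m ⟨A, h1, h2, rfl⟩; exact sap_bound h1 h2
  · refine sSup_prop _ n ?_ (fun m => (m + 1).choose 2 ≤ n + ec G) (by simp) ?_
    · rintro m ⟨A, -, -, -, rfl⟩; exact nullity_le A
    · rintro m ⟨A, h1, -, h2, rfl⟩; exact sap_bound h1 h2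
  · refine sSup_prop _ n ?_ (fun m => (m + 1).choose 2 ≤ n + ec G) (by simp) ?_
    · rintro m ⟨A, -, -, -, -, -, rfl⟩; exact nullity_le A
    · rintro m ⟨A, -, h1, h2, -, -, rfl⟩; exact sap_bound h1 h2
  · refine sSup_prop _ n ?_ (fun m => (m + 1).choose 2 ≤ n + ec G) (by simp) ?_
    · intro m h; exact minor_le h
    · intro m h; exact minor_bound h

lemma sum_ec {n r : ℕ} {G : Fin r → SimpleGraph (Fin n)} (hG : IsDecomp G) :
    ∑ k, ec (G k) ≤ (n + 1).choose 2 := by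
  unfold ec
  rw [← Finset.card_biUnion]
  · refine (Finset.card_le_univ _).trans ?_
    simp [Sym2.card]
  · intro i _ j _ hij
    refine Finset.disjoint_left.2 ?_
    intro e h1 h2
    simp only [Finset.mem_filter, Finset.mem_univ, true_and] at h1 h2
    have := hG.1 i j hij
    rw [← SimpleGraph.disjoint_edgeSet] at this
    exact Set.disjoint_left.1 this h1 h2

lemma sum_sq {r : ℕ} (β : (n : ℕ) → SimpleGraph (Fin n) → ℕ)
    (hβ : β = NG.xiParam ∨ β = NG.nuParam ∨ β = NG.muParam ∨ β = NG.hadwiger)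
    (n : ℕ) (G : Fin r → SimpleGraph (Fin n)) (hG : IsDecomp G) :
    ∑ k, (β n (G k) : ℝ) ^ 2 ≤ (n : ℝ) ^ 2 + (2 * r + 1) * n := by
  have h1 : ∀ k, (β n (G k) : ℝ) ^ 2 ≤ 2 * (n : ℝ) + 2 * (ec (G k) : ℝ) := by
    intro k
    have h := upper_bound β hβ n (G k)
    have h' : (((β n (G k) + 1).choose 2 : ℕ) : ℝ) ≤ n + ec (G k) := by exact_mod_cast h
    rw [Nat.cast_choose_two] at h'
    push_cast at h'
    have : (0 : ℝ) ≤ β n (G k) := by positivity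
    nlinarith
  have h2 : (∑ k, (ec (G k) : ℝ)) ≤ (n + 1) * n / 2 := by
    have h := sum_ec hG
    have h' : ((∑ k, ec (G k) : ℕ) : ℝ) ≤ (((n + 1).choose 2 : ℕ) : ℝ) := by exact_mod_cast h
    rw [Nat.cast_choose_two] at h'
    push_cast at h'
    linarith
  calc ∑ k, (β n (G k) : ℝ) ^ 2 ≤ ∑ k, (2 * (n : ℝ) + 2 * (ec (G k) : ℝ)) :=
        Finset.sum_le_sum fun k _ => h1 k
    _ = r * (2 * n) + 2 * ∑ k, (ec (G k) : ℝ) := by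
        rw [Finset.sum_add_distrib, Finset.mul_sum]; simp
    _ ≤ _ := by nlinarith

lemma prod_le {r : ℕ} (hr : 2 ≤ r) (β : (n : ℕ) → SimpleGraph (Fin n) → ℕ)
    (hβ : β = NG.xiParam ∨ β = NG.nuParam ∨ β = NG.muParam ∨ β = NG.hadwiger)
    (n : ℕ) (G : Fin r → SimpleGraph (Fin n)) (hG : IsDecomp G) :
    ∏ k, (β n (G k) : ℝ) ≤ Real.sqrt (((n : ℝ) ^ 2 + (2 * r + 1) * n) / r) ^ r := by
  have hr0 : (0 : ℝ) < r := by positivity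
  have h := sum_sq β hβ n G hG
  have hg := Real.geom_mean_le_arith_mean Finset.univ (fun _ : Fin r => (1 : ℝ))
    (fun k => (β n (G k) : ℝ) ^ 2) (fun _ _ => zero_le_one) (by simp; omega)
    (fun _ _ => by positivity)
  simp only [Real.rpow_one, Finset.sum_const, Finset.card_univ, Fintype.card_fin, nsmul_eq_mul,
    mul_one, one_mul] at hg
  have hg2 : (∏ k, (β n (G k) : ℝ) ^ 2) ^ ((r : ℝ)⁻¹) ≤ ((n : ℝ) ^ 2 + (2 * r + 1) * n) / r :=
    hg.trans (by gcongr)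
  have hp : 0 ≤ ∏ k, (β n (G k) : ℝ) ^ 2 := Finset.prod_nonneg fun _ _ => by positivity
  have hg3 := pow_le_pow_left₀ (Real.rpow_nonneg hp _) hg2 r
  rw [Real.rpow_inv_natCast_pow hp (by omega)] at hg3
  refine abs_le_of_sq_le_sq' ?_ (by positivity) |>.2
  rw [← Finset.prod_pow, ← pow_mul, mul_comm r 2, pow_mul, Real.sq_sqrt (by positivity)]
  exact hg3

end NG
namespace NG
open Matrix

lemma one_neg {n : ℕ} (A : Matrix (Fin n) (Fin n) ℝ) (hA : A.IsHermitian) (u : Fin n → ℝ)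
    (h1 : (A + vecMulVec u u).PosSemidef) (h2 : ¬ A.PosSemidef) :
    (Finset.univ.filter (fun i => hA.eigenvalues i < 0)).card = 1 := by
  apply le_antisymm
  · rw [Finset.card_le_one]
    intro i hi j hj
    simp only [Finset.mem_filter, Finset.mem_univ, true_and] at hi hj
    by_contra hij
    let vi : Fin n → ℝ := ⇑(hA.eigenvectorBasis i)
    let vj : Fin n → ℝ := ⇑(hA.eigenvectorBasis j)
    have ei : A *ᵥ vi = hA.eigenvalues i • vi := hA.mulVec_eigenvectorBasis i
    have ej : A *ᵥ vj = hA.eigenvalues j • vj := hA.mulVec_eigenvectorBasis j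
    have on := hA.eigenvectorBasis.orthonormal
    have hii : vi ⬝ᵥ vi = 1 := by
      have := orthonormal_iff_ite.1 on i i
      rw [if_pos rfl, PiLp.inner_apply] at this
      simpa only [dotProduct, vi, RCLike.inner_apply, conj_trivial] using this
    have hjj : vj ⬝ᵥ vj = 1 := by
      have := orthonormal_iff_ite.1 on j j
      rw [if_pos rfl, PiLp.inner_apply] at this
      simpa only [dotProduct, vj, RCLike.inner_apply, conj_trivial] using this
    have hijd : vi ⬝ᵥ vj = 0 := by
      have := orthonormal_iff_ite.1 on j i
      rw [if_neg (Ne.symm hij)] at this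
      simpa [PiLp.inner_apply, dotProduct, vi, vj] using this
    have hjid : vj ⬝ᵥ vi = 0 := by rw [dotProduct_comm]; exact hijd
    have q : ∀ a b : ℝ, 0 ≤ a ^ 2 * hA.eigenvalues i + b ^ 2 * hA.eigenvalues j
        + (a * (u ⬝ᵥ vi) + b * (u ⬝ᵥ vj)) ^ 2 := by
      intro a b
      have := h1.dotProduct_mulVec_nonneg (a • vi + b • vj)
      simp only [star_trivial, add_mulVec, mulVec_add, mulVec_smul, ei, ej, dotProduct_add,
        add_dotProduct, smul_dotProduct, dotProduct_smul, hii, hjj, hijd, hjid, smul_eq_mul,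
        vecMulVec_mulVec, op_smul_eq_smul] at this
      rw [dotProduct_comm vi u, dotProduct_comm vj u] at this
      nlinarith
    by_cases h0 : u ⬝ᵥ vi = 0
    · have := q 1 0
      rw [h0] at this
      nlinarith
    · have := q (u ⬝ᵥ vj) (-(u ⬝ᵥ vi))
      have h3 : 0 < (u ⬝ᵥ vi) ^ 2 := by positivity
      have h4 : 0 ≤ (u ⬝ᵥ vj) ^ 2 := by positivity
      nlinarith
  · rw [Nat.one_le_iff_ne_zero, Finset.card_ne_zero]
    by_contra hc
    apply h2
    rw [hA.posSemidef_iff_eigenvalues_nonneg]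
    intro i
    by_contra h
    exact hc ⟨i, by simpa using h⟩

/-- Strong Arnold property over a general index type. -/
def SAPg {V : Type} [Fintype V] (A : Matrix V V ℝ) : Prop :=
  ∀ X : Matrix V V ℝ, X.IsSymm → A * X = 0 →
    (∀ i j, A i j * X i j = 0) → (∀ i, X i i = 0) → X = 0

/-- Data giving a large nullity. -/
def Good {n : ℕ} (G : SimpleGraph (Fin n)) (s : ℕ) (V : Type) [Fintype V] (e : V ≃ Fin n)
    (A : Matrix V V ℝ) : Prop :=
  A.IsSymm ∧ (∀ i j, i ≠ j → (A i j ≠ 0 ↔ G.Adj (e i) (e j))) ∧ SAPg A ∧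
  ∃ φ : (Fin s → ℝ) →ₗ[ℝ] (V → ℝ), Function.Injective φ ∧
    ∀ x, ∑ a, x a = 0 → A *ᵥ φ x = 0

lemma Good.out {n : ℕ} {G : SimpleGraph (Fin n)} {s : ℕ} {V : Type} [Fintype V] {e : V ≃ Fin n}
    {A : Matrix V V ℝ} (h : Good G s V e A) :
    DescribesGraph (A.submatrix e.symm e.symm) G ∧ StrongArnold (A.submatrix e.symm e.symm) ∧
    s - 1 ≤ nullity (A.submatrix e.symm e.symm) := by
  obtain ⟨h1, h2, h3, φ, hφ, hk⟩ := h
  refine ⟨⟨?_, ?_⟩, ?_, ?_⟩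
  · ext i j
    exact h1.apply _ _
  · intro i j hij
    have := h2 (e.symm i) (e.symm j) (by simpa using hij)
    simpa using this
  · intro X hX hAX hE hD
    have h0 : X.submatrix e e = 0 := by
      apply h3
      · ext i j; exact hX.apply _ _
      · have : (A.submatrix e.symm e.symm * X).submatrix e e = A * X.submatrix e e := by
          rw [← Matrix.submatrix_mul_equiv _ _ e e e]
          simp
        rw [← this, hAX]; rfl
      · intro i j; simpa using hE (e i) (e j)
      · intro i; exact hD _
    ext i j
    have := congrFun (congrFun h0 (e.symm i)) (e.symm j)
    simpa using this
  · rcases Nat.eq_zero_or_pos s with rfl | hs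
    · simp
    let σ : Module.Dual ℝ (Fin s → ℝ) := ∑ a, LinearMap.proj a
    have hσ : ∀ x, σ x = ∑ a, x a := by intro x; simp [σ]
    have hσ0 : σ ≠ 0 := by
      intro h
      have := hσ (Pi.single ⟨0, hs⟩ 1)
      rw [h] at this
      simp at this
    have hdim : Module.finrank ℝ (LinearMap.ker σ) = s - 1 := by
      have := Module.Dual.finrank_ker_add_one_of_ne_zero hσ0
      rw [Module.finrank_fin_fun] at this
      omega
    rw [← hdim]
    let ψ : (Fin s → ℝ) →ₗ[ℝ] (Fin n → ℝ) := (LinearMap.funLeft ℝ ℝ e.symm) ∘ₗ φ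
    have hψ : Function.Injective ψ :=
      (LinearMap.funLeft_injective_of_surjective ℝ ℝ _ e.symm.surjective).comp hφ
    have hmap : ∀ x ∈ LinearMap.ker σ, ψ x ∈ LinearMap.ker (toLin' (A.submatrix e.symm e.symm)) := by
      intro x hx
      have h0 : A *ᵥ φ x = 0 := hk x (by rw [← hσ]; exact hx)
      rw [LinearMap.mem_ker, toLin'_apply]
      ext i
      have := congrFun h0 (e.symm i)
      simp only [mulVec, dotProduct, submatrix_apply, Pi.zero_apply] at this ⊢
      rw [← this]
      exact Equiv.sum_comp e.symm (fun k => A (e.symm i) k * φ x k)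
    exact LinearMap.finrank_le_finrank_of_injective (f := ψ.restrict hmap)
      (fun a b hab => Subtype.ext (hψ (congrArg Subtype.val hab)))

lemma Good.nu {n : ℕ} {G : SimpleGraph (Fin n)} {s : ℕ} {V : Type} [Fintype V] {e : V ≃ Fin n}
    {A : Matrix V V ℝ} (h : Good G s V e A) (hP : A.PosSemidef) : s - 1 ≤ nuParam n G := by
  obtain ⟨h1, h2, h3⟩ := h.out
  refine h3.trans (le_csSup ⟨n, ?_⟩ ⟨_, h1, hP.submatrix _, h2, rfl⟩)
  rintro m ⟨A, -, -, -, rfl⟩; exact nullity_le A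

lemma Good.xi {n : ℕ} {G : SimpleGraph (Fin n)} {s : ℕ} {V : Type} [Fintype V] {e : V ≃ Fin n}
    {A : Matrix V V ℝ} (h : Good G s V e A) : s - 1 ≤ xiParam n G := by
  obtain ⟨h1, h2, h3⟩ := h.out
  refine h3.trans (le_csSup ⟨n, ?_⟩ ⟨_, h1, h2, rfl⟩)
  rintro m ⟨A, -, -, rfl⟩; exact nullity_le A

lemma Good.mu {n : ℕ} {G : SimpleGraph (Fin n)} {s : ℕ} {V : Type} [Fintype V] {e : V ≃ Fin n}
    {A : Matrix V V ℝ} (h : Good G s V e A) (u : V → ℝ) (hP : (A + vecMulVec u u).PosSemidef)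
    (hN : ¬ A.PosSemidef) (hle : ∀ i j, i ≠ j → A i j ≤ 0) : s - 1 ≤ muParam n G := by
  obtain ⟨h1, h2, h3⟩ := h.out
  have hH : (A.submatrix e.symm e.symm).IsHermitian := by
    ext i j
    exact h1.1.apply i j
  refine h3.trans (le_csSup ⟨n, ?_⟩ ⟨_, hH, h1, h2, ?_, ?_, rfl⟩)
  · rintro m ⟨A, -, -, -, -, -, rfl⟩; exact nullity_le A
  · apply one_neg _ _ (u ∘ e.symm)
    · exact hP.submatrix e.symm
    · intro hc
      apply hN
      have := hc.submatrix e
      simpa using this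
  · intro i j hij
    exact hle _ _ (by simpa using hij)

/-- Block criterion for the Strong Arnold property. -/
lemma sap_block {P R : Type} [Fintype P] [Fintype R] [DecidableEq R]
    (M : Matrix P P ℝ) (C : Matrix P R ℝ) (D : Matrix R R ℝ) (hD : IsUnit D.det)
    (h : ∀ X : Matrix (P ⊕ R) (P ⊕ R) ℝ, X.IsSymm → fromBlocks M C Cᵀ D * X = 0 →
      (∀ i j, fromBlocks M C Cᵀ D i j * X i j = 0) → (∀ i, X i i = 0) → X.toBlocks₁₁ = 0) :
    SAPg (fromBlocks M C Cᵀ D) := by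
  intro X hX hAX hE hI
  have h11 := h X hX hAX hE hI
  have hXb : X = fromBlocks X.toBlocks₁₁ X.toBlocks₁₂ X.toBlocks₂₁ X.toBlocks₂₂ :=
    (fromBlocks_toBlocks X).symm
  have hinv : ∀ {Q : Type} (Y : Matrix R Q ℝ), D * Y = 0 → Y = 0 := by
    intro Q Y hY
    have := congrArg (fun Z => D⁻¹ * Z) hY
    simpa [← Matrix.mul_assoc, Matrix.nonsing_inv_mul D hD] using this
  rw [hXb, fromBlocks_multiply, h11] at hAX
  have h21 : X.toBlocks₂₁ = 0 := by
    apply hinv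
    have := congrArg toBlocks₂₁ hAX
    rw [toBlocks_fromBlocks₂₁] at this
    simp only [Matrix.mul_zero, zero_add] at this
    exact this
  have h12 : X.toBlocks₁₂ = 0 := by
    ext i j
    have : X (Sum.inr j) (Sum.inl i) = 0 := congrFun (congrFun h21 j) i
    rw [← hX.apply] at this
    exact this
  have h22 : X.toBlocks₂₂ = 0 := by
    apply hinv
    have := congrArg toBlocks₂₂ hAX
    rw [toBlocks_fromBlocks₂₂, h12] at this
    simp only [Matrix.mul_zero, zero_add] at this
    exact this
  rw [hXb, h11, h12, h21, h22]
  exact fromBlocks_zero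
end NG
namespace NG
open Matrix

/-- Split the vertex set along an embedding. -/
noncomputable def splitEquiv {n : ℕ} {α : Type} (f : α ↪ Fin n) :
    α ⊕ ↥((Set.range f)ᶜ) ≃ Fin n :=
  (Equiv.sumCongr (Equiv.ofInjective f f.injective) (Equiv.refl _)).trans
    (Equiv.Set.sumCompl (Set.range f))

@[simp] lemma splitEquiv_inl {n : ℕ} {α : Type} (f : α ↪ Fin n) (a : α) :
    splitEquiv f (Sum.inl a) = f a := by simp [splitEquiv]

@[simp] lemma splitEquiv_inr {n : ℕ} {α : Type} (f : α ↪ Fin n) (a : ↥((Set.range f)ᶜ)) :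
    splitEquiv f (Sum.inr a) = a := by simp [splitEquiv]

/-- all-ones matrix -/
def JJ (s : ℕ) : Matrix (Fin s) (Fin s) ℝ := vecMulVec 1 1

lemma JJ_apply (s : ℕ) (a b : Fin s) : JJ s a b = 1 := by simp [JJ, vecMulVec_apply]

lemma JJ_mulVec (s : ℕ) (x : Fin s → ℝ) (h : ∑ a, x a = 0) : JJ s *ᵥ x = 0 := by
  ext a
  simp [mulVec, dotProduct, JJ_apply, h]

lemma JJ_psd (s : ℕ) : (JJ s).PosSemidef := by
  have := posSemidef_vecMulVec_self_star (1 : Fin s → ℝ)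
  simpa [JJ] using this

lemma JJ_mul (s : ℕ) : JJ s * JJ s = (s : ℝ) • JJ s := by
  ext a b
  simp [mul_apply, JJ_apply]

lemma clique_data {n s : ℕ} (G : SimpleGraph (Fin n)) (f : Fin s ↪ Fin n)
    (hf : ∀ a b, a ≠ b → G.Adj (f a) (f b)) (σ : ℝ) (hσ : |σ| = 1) :
    ∃ (M : Matrix (Fin s) (Fin s) ℝ) (C : Matrix (Fin s) ↥((Set.range f)ᶜ) ℝ)
      (D : Matrix ↥((Set.range f)ᶜ) ↥((Set.range f)ᶜ) ℝ),
      Good G s _ (splitEquiv f) (fromBlocks M C Cᵀ D) ∧ D.PosDef ∧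
      M - C * D⁻¹ * Cᵀ = σ • JJ s ∧ (∀ a b, |M a b - σ| < 1) ∧ (∀ a b, C a b ≤ 0) ∧
      (∀ a b, a ≠ b → D a b ≤ 0) := by
  set R := ↥((Set.range f)ᶜ) with hR
  let H : SimpleGraph R := G.comap (fun v : R => (v : Fin n))
  let D : Matrix R R ℝ := H.lapMatrix ℝ + 1
  have hD : D.PosDef := PosDef.posSemidef_add (SimpleGraph.posSemidef_lapMatrix ℝ H) PosDef.one
  have hDs : Dᵀ = D := hD.isHermitian
  have hDu : IsUnit D.det := (Matrix.isUnit_iff_isUnit_det D).1 hD.isUnit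
  have hDa : ∀ a b, a ≠ b → D a b = if G.Adj a b then -1 else 0 := by
    intro a b hab
    simp only [D, SimpleGraph.lapMatrix, SimpleGraph.degMatrix, Matrix.add_apply,
      Matrix.sub_apply, diagonal_apply_ne _ hab, one_apply_ne hab, SimpleGraph.adjMatrix_apply, H,
      SimpleGraph.comap_adj]
    split_ifs <;> simp
  let C0 : Matrix (Fin s) R ℝ := fun a v => if G.Adj (f a) v then 1 else 0
  let K : Matrix (Fin s) (Fin s) ℝ := C0 * D⁻¹ * C0ᵀ
  have hKs : Kᵀ = K := by
    simp only [K, transpose_mul, transpose_transpose, transpose_nonsing_inv, hDs, Matrix.mul_assoc]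
  let S : ℝ := ∑ a, ∑ b, |K a b|
  have hS : ∀ a b, |K a b| ≤ S := by
    intro a b
    refine (Finset.single_le_sum (f := fun b => |K a b|) (fun _ _ => abs_nonneg _)
      (Finset.mem_univ b)).trans ?_
    exact Finset.single_le_sum (f := fun a => ∑ b, |K a b|)
      (fun _ _ => Finset.sum_nonneg fun _ _ => abs_nonneg _) (Finset.mem_univ a)
  have hS0 : 0 ≤ S := Finset.sum_nonneg fun _ _ => Finset.sum_nonneg fun _ _ => abs_nonneg _
  let ε : ℝ := 1 / (1 + S)
  have hε : 0 < ε := by positivity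
  have hε1 : ε ≤ 1 := by
    rw [div_le_one (by positivity)]; linarith
  have hεS : ε * S < 1 := by
    rw [div_mul_eq_mul_div, div_lt_one (by positivity)]; linarith
  let C : Matrix (Fin s) R ℝ := -ε • C0
  let M : Matrix (Fin s) (Fin s) ℝ := σ • JJ s + ε ^ 2 • K
  have hM1 : ∀ a b, |M a b - σ| < 1 := by
    intro a b
    have : M a b - σ = ε ^ 2 * K a b := by simp [M, JJ_apply]
    rw [this, abs_mul, abs_of_nonneg (by positivity)]
    have h1 := hS a b
    have h2 := abs_nonneg (K a b)
    nlinarith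
  have hM0 : ∀ a b, M a b ≠ 0 := by
    intro a b h
    have := hM1 a b
    rw [h, zero_sub, abs_neg, hσ] at this
    exact lt_irrefl _ this
  have hsch : M - C * D⁻¹ * Cᵀ = σ • JJ s := by
    have : C * D⁻¹ * Cᵀ = ε ^ 2 • K := by
      simp [C, K, smul_smul, pow_two]
    rw [this]; simp [M]
  have hCa : ∀ a v, C a v = -ε * (if G.Adj (f a) v then 1 else 0) := fun a v => rfl
  have hC0 : ∀ a v, C a v ≠ 0 ↔ G.Adj (f a) v := by
    intro a v
    rw [hCa]
    split_ifs with h <;> simp [h, hε.ne']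
  refine ⟨M, C, D, ⟨?_, ?_, ?_, ?_⟩, hD, hsch, hM1, ?_, ?_⟩
  · have hMs : Mᵀ = M := by
      simp only [M, transpose_add, transpose_smul, hKs]
      have : (JJ s)ᵀ = JJ s := by ext a b; simp [JJ_apply]
      rw [this]
    rw [Matrix.IsSymm, fromBlocks_transpose, hMs, hDs, transpose_transpose]
  · rintro (a | a) (b | b) hab
    · have hab' : a ≠ b := fun h => hab (by rw [h])
      simp only [fromBlocks_apply₁₁, splitEquiv_inl]
      exact ⟨fun _ => hf a b hab', fun _ => hM0 a b⟩
    · simp only [fromBlocks_apply₁₂, splitEquiv_inl, splitEquiv_inr]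
      exact hC0 a b
    · simp only [fromBlocks_apply₂₁, splitEquiv_inl, splitEquiv_inr, transpose_apply]
      rw [G.adj_comm]
      exact hC0 b a
    · have hab' : a ≠ b := fun h => hab (by rw [h])
      simp only [fromBlocks_apply₂₂, splitEquiv_inr]
      rw [hDa a b hab']
      split_ifs with h <;> simp [h]
  · apply sap_block _ _ _ hDu
    intro X _ _ hE hI
    ext a b
    have := hE (Sum.inl a) (Sum.inl b)
    rw [fromBlocks_apply₁₁] at this
    exact (mul_eq_zero.1 this).resolve_left (hM0 a b)
  · let φ : (Fin s → ℝ) →ₗ[ℝ] (Fin s ⊕ R → ℝ) :=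
      { toFun := fun x => Sum.elim x (-((D⁻¹ * Cᵀ) *ᵥ x))
        map_add' := by
          intro x y; ext (i | i) <;> simp [mulVec_add]; ring
        map_smul' := by
          intro c x; ext (i | i) <;> simp [mulVec_smul] }
    refine ⟨φ, ?_, ?_⟩
    · intro x y hxy
      ext i
      exact congrFun hxy (Sum.inl i)
    · intro x hx
      have h1 : φ x = Sum.elim x (-((D⁻¹ * Cᵀ) *ᵥ x)) := rfl
      rw [h1, fromBlocks_mulVec]
      simp only [Sum.elim_comp_inl, Sum.elim_comp_inr, mulVec_neg, mulVec_mulVec]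
      have h2 : M *ᵥ x + -((C * (D⁻¹ * Cᵀ)) *ᵥ x) = 0 := by
        rw [← sub_eq_add_neg, ← sub_mulVec, ← Matrix.mul_assoc, hsch, smul_mulVec,
          JJ_mulVec s x hx, smul_zero]
      have h3 : Cᵀ *ᵥ x + -((D * (D⁻¹ * Cᵀ)) *ᵥ x) = 0 := by
        rw [← Matrix.mul_assoc, Matrix.mul_nonsing_inv D hDu, Matrix.one_mul, add_neg_cancel]
      rw [h2, h3]
      ext (i | i) <;> rfl
  · intro a b
    rw [hCa]
    split_ifs <;> simp [hε.le]
  · intro a b hab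
    rw [hDa a b hab]
    split_ifs <;> simp

lemma clique_xi_nu {n s : ℕ} (G : SimpleGraph (Fin n)) (f : Fin s ↪ Fin n)
    (hf : ∀ a b, a ≠ b → G.Adj (f a) (f b)) : s - 1 ≤ xiParam n G ∧ s - 1 ≤ nuParam n G := by
  obtain ⟨M, C, D, hg, hD, hs, -, -, -⟩ := clique_data G f hf 1 (by simp)
  refine ⟨hg.xi, hg.nu ?_⟩
  have := hD.isUnit.invertible
  have := (PosDef.fromBlocks₂₂ M C hD).2
  rw [conjTranspose_eq_transpose_of_trivial, hs, one_smul] at this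
  exact this (JJ_psd s)

lemma clique_mu {n s : ℕ} (hs0 : 0 < s) (G : SimpleGraph (Fin n)) (f : Fin s ↪ Fin n)
    (hf : ∀ a b, a ≠ b → G.Adj (f a) (f b)) : s - 1 ≤ muParam n G := by
  obtain ⟨M, C, D, hg, hD, hs, h1, h2, h3⟩ := clique_data G f hf (-1) (by simp)
  have := hD.isUnit.invertible
  have hM : ∀ a b, M a b < 0 := by
    intro a b
    have := (abs_lt.1 (h1 a b)).2
    linarith
  refine hg.mu (Sum.elim 1 0) ?_ ?_ ?_
  · have h4 : fromBlocks M C Cᵀ D + vecMulVec (Sum.elim 1 0) (Sum.elim 1 0) =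
        fromBlocks (M + JJ s) C Cᵀ D := by
      ext (i | i) (j | j) <;> simp [vecMulVec_apply, JJ_apply]
    have := (PosDef.fromBlocks₂₂ (M + JJ s) C hD).2
    rw [conjTranspose_eq_transpose_of_trivial, add_sub_right_comm, hs] at this
    rw [h4]
    apply this
    simp [PosSemidef.zero]
  · intro h
    have := h.diag_nonneg (i := Sum.inl ⟨0, hs0⟩)
    rw [fromBlocks_apply₁₁] at this
    exact absurd (hM _ _) (not_lt.2 this)
  · rintro (a | a) (b | b) hab
    · exact (hM a b).le
    · exact h2 a b
    · exact h2 b a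
    · exact h3 a b (fun h => hab (by rw [h]))

/-- The biclique block matrix. -/
def BB (s : ℕ) (b : ℝ) : Matrix (Fin s) (Fin s) ℝ := 1 + b • JJ s

lemma BB_symm (s : ℕ) (b : ℝ) : (BB s b)ᵀ = BB s b := by
  ext i j
  simp [BB, JJ_apply, one_apply, eq_comm]

lemma BB_sq (s : ℕ) (b : ℝ) : BB s b * BB s b = 1 + (2 * b + s * b ^ 2) • JJ s := by
  simp only [BB, Matrix.add_mul, Matrix.mul_add, Matrix.one_mul, Matrix.mul_one, Matrix.smul_mul,
    Matrix.mul_smul, JJ_mul, smul_smul]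
  module

lemma biclique_good {n s : ℕ} (G : SimpleGraph (Fin n)) (f : Fin s ⊕ Fin s ↪ Fin n)
    (h12 : ∀ a c, G.Adj (f (Sum.inl a)) (f (Sum.inr c)))
    (h11 : ∀ a c, ¬ G.Adj (f (Sum.inl a)) (f (Sum.inl c)))
    (h22 : ∀ a c, ¬ G.Adj (f (Sum.inr a)) (f (Sum.inr c)))
    (hR : ∀ u v, u ∉ Set.range f → ¬ G.Adj u v)
    (b : ℝ) (hb : b ≠ 0) (hb1 : 1 + b ≠ 0) :
    Good G s _ (splitEquiv f)
      (fromBlocks (fromBlocks 1 (-BB s b) (-BB s b) 1) 0 0ᵀ 1) := by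
  have hB0 : ∀ a c, BB s b a c ≠ 0 := by
    intro a c
    simp only [BB, Matrix.add_apply, one_apply, Matrix.smul_apply, JJ_apply]
    split_ifs <;> simpa
  refine ⟨?_, ?_, ?_, ?_⟩
  · rw [Matrix.IsSymm, fromBlocks_transpose, fromBlocks_transpose]
    simp [BB_symm]
  · rintro ((a | a) | a) ((c | c) | c) hac
    · have hac' : a ≠ c := fun h => hac (by rw [h])
      simp [h11, one_apply_ne hac']
    · simp [h12, hB0]
    · simp only [fromBlocks_apply₁₂, splitEquiv_inl, splitEquiv_inr]
      rw [G.adj_comm]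
      simp [hR _ _ c.2]
    · simp [(h12 c a).symm, hB0]
    · have hac' : a ≠ c := fun h => hac (by rw [h])
      simp [h22, one_apply_ne hac']
    · simp only [fromBlocks_apply₁₂, splitEquiv_inl, splitEquiv_inr]
      rw [G.adj_comm]
      simp [hR _ _ c.2]
    · simp [hR _ _ a.2]
    · simp [hR _ _ a.2]
    · have hac' : a ≠ c := fun h => hac (by rw [h])
      simp [hR _ _ a.2, one_apply_ne hac']
  · apply sap_block _ _ _ (by simp)
    intro X hX hAX hE hI
    have e12 : ∀ a c, X (Sum.inl (Sum.inl a)) (Sum.inl (Sum.inr c)) = 0 := by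
      intro a c
      have := hE (Sum.inl (Sum.inl a)) (Sum.inl (Sum.inr c))
      simpa [hB0] using this
    have e21 : ∀ a c, X (Sum.inl (Sum.inr a)) (Sum.inl (Sum.inl c)) = 0 := by
      intro a c
      rw [hX.apply]; exact e12 c a
    ext (a | a) (c | c)
    · have := congrFun (congrFun hAX (Sum.inl (Sum.inl a))) (Sum.inl (Sum.inl c))
      simp [mul_apply, e21, one_apply] at this
      exact this
    · exact e12 a c
    · exact e21 a c
    · have := congrFun (congrFun hAX (Sum.inl (Sum.inr a))) (Sum.inl (Sum.inr c))
      simp [mul_apply, e12, one_apply] at this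
      exact this
  · let φ : (Fin s → ℝ) →ₗ[ℝ] ((Fin s ⊕ Fin s) ⊕ ↥((Set.range f)ᶜ) → ℝ) :=
      { toFun := fun x => Sum.elim (Sum.elim x x) 0
        map_add' := by
          intro x y; ext ((i | i) | i) <;> simp
        map_smul' := by
          intro c x; ext ((i | i) | i) <;> simp }
    refine ⟨φ, ?_, ?_⟩
    · intro x y hxy
      ext i
      exact congrFun hxy (Sum.inl (Sum.inl i))
    · intro x hx
      have h1 : φ x = Sum.elim (Sum.elim x x) 0 := rfl
      have h2 : BB s b *ᵥ x = x := by
        rw [BB, add_mulVec, one_mulVec, smul_mulVec, JJ_mulVec s x hx, smul_zero, add_zero]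
      rw [h1, fromBlocks_mulVec]
      simp only [Sum.elim_comp_inl, Sum.elim_comp_inr]
      rw [fromBlocks_mulVec]
      simp only [Sum.elim_comp_inl, Sum.elim_comp_inr, neg_mulVec, h2, one_mulVec]
      ext ((i | i) | i) <;> simp

lemma psd_outer {P R : Type} [Fintype P] [Fintype R] [DecidableEq R] (M : Matrix P P ℝ) :
    (fromBlocks M 0 0ᵀ (1 : Matrix R R ℝ)).PosSemidef ↔ M.PosSemidef := by
  have : Invertible (1 : Matrix R R ℝ) := invertibleOne
  have := PosDef.fromBlocks₂₂ M (0 : Matrix P R ℝ) (PosDef.one)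
  rw [conjTranspose_eq_transpose_of_trivial] at this
  simpa using this

lemma psd_inner {s : ℕ} (M : Matrix (Fin s) (Fin s) ℝ) (b : ℝ) :
    (fromBlocks M (-BB s b) (-BB s b) 1).PosSemidef ↔
      (M - (1 + (2 * b + s * b ^ 2) • JJ s)).PosSemidef := by
  have : Invertible (1 : Matrix (Fin s) (Fin s) ℝ) := invertibleOne
  have := PosDef.fromBlocks₂₂ M (-BB s b) (PosDef.one)
  rw [conjTranspose_eq_transpose_of_trivial, transpose_neg, BB_symm] at this
  simpa [BB_sq] using this

lemma biclique_xi_nu {n s : ℕ} (hs : 3 ≤ s) (G : SimpleGraph (Fin n)) (f : Fin s ⊕ Fin s ↪ Fin n)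
    (h12 : ∀ a c, G.Adj (f (Sum.inl a)) (f (Sum.inr c)))
    (h11 : ∀ a c, ¬ G.Adj (f (Sum.inl a)) (f (Sum.inl c)))
    (h22 : ∀ a c, ¬ G.Adj (f (Sum.inr a)) (f (Sum.inr c)))
    (hR : ∀ u v, u ∉ Set.range f → ¬ G.Adj u v) : s - 1 ≤ xiParam n G ∧ s - 1 ≤ nuParam n G := by
  have hs' : (3 : ℝ) ≤ s := by exact_mod_cast hs
  have hg := biclique_good G f h12 h11 h22 hR (-2 / s) (by
      apply div_ne_zero <;> linarith) (by
      intro h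
      field_simp at h
      linarith)
  refine ⟨hg.xi, hg.nu ?_⟩
  rw [psd_outer, psd_inner]
  have : (2 * (-2 / s) + s * (-2 / s) ^ 2 : ℝ) = 0 := by field_simp; ring
  rw [this]
  simp [PosSemidef.zero]

lemma biclique_mu {n s : ℕ} (hs : 3 ≤ s) (G : SimpleGraph (Fin n)) (f : Fin s ⊕ Fin s ↪ Fin n)
    (h12 : ∀ a c, G.Adj (f (Sum.inl a)) (f (Sum.inr c)))
    (h11 : ∀ a c, ¬ G.Adj (f (Sum.inl a)) (f (Sum.inl c)))
    (h22 : ∀ a c, ¬ G.Adj (f (Sum.inr a)) (f (Sum.inr c)))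
    (hR : ∀ u v, u ∉ Set.range f → ¬ G.Adj u v) : s - 1 ≤ muParam n G := by
  have hg := biclique_good G f h12 h11 h22 hR 1 (by norm_num) (by norm_num)
  refine hg.mu (Sum.elim (Sum.elim (fun _ => Real.sqrt (2 + s)) 0) 0) ?_ ?_ ?_
  · have h4 : ∀ M : Matrix (Fin s) (Fin s) ℝ,
        fromBlocks (fromBlocks M (-BB s 1) (-BB s 1) 1) 0 0ᵀ
          (1 : Matrix ↥((Set.range f)ᶜ) ↥((Set.range f)ᶜ) ℝ) +
        vecMulVec (Sum.elim (Sum.elim (fun _ => Real.sqrt (2 + s)) 0) 0)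
          (Sum.elim (Sum.elim (fun _ => Real.sqrt (2 + s)) 0) 0) =
        fromBlocks (fromBlocks (M + (2 + s : ℝ) • JJ s) (-BB s 1) (-BB s 1) 1) 0 0ᵀ 1 := by
      intro M
      have : Real.sqrt (2 + s) * Real.sqrt (2 + s) = 2 + s := Real.mul_self_sqrt (by positivity)
      ext ((i | i) | i) ((j | j) | j) <;> simp [vecMulVec_apply, JJ_apply, this]
    rw [h4, psd_outer, psd_inner]
    simp [PosSemidef.zero]
  · rw [psd_outer, psd_inner]
    intro h
    have := h.diag_nonneg (i := ⟨0, by omega⟩)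
    simp [JJ_apply] at this
    have h2 : (0 : ℝ) ≤ s := by positivity
    linarith
  · have hB : ∀ a c, 0 ≤ BB s 1 a c := by
      intro a c
      simp only [BB, Matrix.add_apply, one_apply, Matrix.smul_apply, JJ_apply]
      split_ifs <;> simp
    rintro ((a | a) | a) ((c | c) | c) hac
    · have hac' : a ≠ c := fun h => hac (by rw [h])
      simp [one_apply_ne hac']
    · simp [hB]
    · simp
    · simp [hB]
    · have hac' : a ≠ c := fun h => hac (by rw [h])
      simp [one_apply_ne hac']
    · simp
    · simp
    · simp
    · have hac' : a ≠ c := fun h => hac (by rw [h])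
      simp [one_apply_ne hac']

lemma hadwiger_ge {n m : ℕ} {G : SimpleGraph (Fin n)} (h : HasCliqueMinor G m) :
    m ≤ hadwiger n G :=
  le_csSup ⟨n, fun _ h => minor_le h⟩ h

lemma clique_eta {n s : ℕ} (G : SimpleGraph (Fin n)) (f : Fin s ↪ Fin n)
    (hf : ∀ a b, a ≠ b → G.Adj (f a) (f b)) : s ≤ hadwiger n G := by
  apply hadwiger_ge
  refine ⟨fun p => {f p}, by simp, ?_, ?_, ?_⟩
  · intro p
    rw [Finset.coe_singleton]
    have : Unique ↥({f p} : Set (Fin n)) := Set.uniqueSingleton _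
    exact SimpleGraph.Connected.mk (fun u v => by rw [Subsingleton.elim u v])
  · intro p q hpq
    simpa using hpq
  · intro p q hpq
    simpa using hf p q hpq

lemma biclique_eta {n s : ℕ} (G : SimpleGraph (Fin n)) (f : Fin s ⊕ Fin s ↪ Fin n)
    (h12 : ∀ a c, G.Adj (f (Sum.inl a)) (f (Sum.inr c))) : s ≤ hadwiger n G := by
  apply hadwiger_ge
  refine ⟨fun p => {f (Sum.inl p), f (Sum.inr p)}, by simp, ?_, ?_, ?_⟩
  · intro p
    have : (({f (Sum.inl p), f (Sum.inr p)} : Finset (Fin n)) : Set (Fin n)) =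
        {f (Sum.inl p), f (Sum.inr p)} := by ext; simp
    rw [this]
    exact SimpleGraph.induce_pair_connected_of_adj (h12 p p)
  · intro p q hpq
    simp [hpq.symm]
  · intro p q hpq
    exact ⟨f (Sum.inl p), by simp, f (Sum.inr q), by simp, h12 p q⟩
end NG
namespace NG

lemma clique_all (β : (n : ℕ) → SimpleGraph (Fin n) → ℕ)
    (hβ : β = NG.xiParam ∨ β = NG.nuParam ∨ β = NG.muParam ∨ β = NG.hadwiger)
    {n s : ℕ} (hs : 3 ≤ s) (G : SimpleGraph (Fin n)) (f : Fin s ↪ Fin n)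
    (hf : ∀ a b, a ≠ b → G.Adj (f a) (f b)) : s - 1 ≤ β n G := by
  rcases hβ with rfl | rfl | rfl | rfl
  · exact (clique_xi_nu G f hf).1
  · exact (clique_xi_nu G f hf).2
  · exact clique_mu (by omega) G f hf
  · exact (Nat.sub_le _ _).trans (clique_eta G f hf)

lemma biclique_all (β : (n : ℕ) → SimpleGraph (Fin n) → ℕ)
    (hβ : β = NG.xiParam ∨ β = NG.nuParam ∨ β = NG.muParam ∨ β = NG.hadwiger)
    {n s : ℕ} (hs : 3 ≤ s) (G : SimpleGraph (Fin n)) (f : Fin s ⊕ Fin s ↪ Fin n)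
    (h12 : ∀ a c, G.Adj (f (Sum.inl a)) (f (Sum.inr c)))
    (h11 : ∀ a c, ¬ G.Adj (f (Sum.inl a)) (f (Sum.inl c)))
    (h22 : ∀ a c, ¬ G.Adj (f (Sum.inr a)) (f (Sum.inr c)))
    (hR : ∀ u v, u ∉ Set.range f → ¬ G.Adj u v) : s - 1 ≤ β n G := by
  rcases hβ with rfl | rfl | rfl | rfl
  · exact (biclique_xi_nu hs G f h12 h11 h22 hR).1
  · exact (biclique_xi_nu hs G f h12 h11 h22 hR).2
  · exact biclique_mu hs G f h12 h11 h22 hR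
  · exact (Nat.sub_le _ _).trans (biclique_eta G f h12)

/-- The `i`-th block of `s` vertices. -/
def blk {n t s : ℕ} (hn : t * s ≤ n) (i : ℕ) (hi : i < t) (a : Fin s) : Fin n :=
  ⟨i * s + a, by
    have h1 := a.2
    have : (i + 1) * s ≤ t * s := Nat.mul_le_mul_right s hi
    have : (i + 1) * s = i * s + s := by ring
    omega⟩

lemma blk_div {n t s : ℕ} (hn : t * s ≤ n) (i : ℕ) (hi : i < t) (a : Fin s) :
    (blk hn i hi a : ℕ) / s = i := by
  have h1 := a.2
  have h0 : 0 < s := by omega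
  simp only [blk]
  rw [mul_comm, Nat.mul_add_div h0, Nat.div_eq_of_lt h1, add_zero]

lemma blk_inj {n t s : ℕ} (hn : t * s ≤ n) (i : ℕ) (hi : i < t) :
    Function.Injective (blk hn i hi) := by
  intro a b h
  have := congrArg Fin.val h
  simp only [blk] at this
  ext; omega

lemma blk_of {n t s : ℕ} (hs : 0 < s) (hn : t * s ≤ n) (i : ℕ) (hi : i < t) (u : Fin n)
    (h : (u : ℕ) / s = i) : ∃ a, blk hn i hi a = u := by
  refine ⟨⟨(u : ℕ) % s, Nat.mod_lt _ hs⟩, ?_⟩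
  ext
  simp only [blk]
  rw [← h, mul_comm]
  exact Nat.div_add_mod _ _

lemma exists_decomp (β : (n : ℕ) → SimpleGraph (Fin n) → ℕ)
    (hβ : β = NG.xiParam ∨ β = NG.nuParam ∨ β = NG.muParam ∨ β = NG.hadwiger)
    (r t s n : ℕ) (hr : 0 < r) (hrt : r ≤ (t + 1).choose 2) (hs : 3 ≤ s) (hn : t * s ≤ n) :
    ∃ G : Fin r → SimpleGraph (Fin n), IsDecomp G ∧ ∀ k, s - 1 ≤ β n (G k) := by
  have ht : 0 < t := by
    rcases Nat.eq_zero_or_pos t with rfl | h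
    · simp at hrt; omega
    · exact h
  let k0 : Fin r := ⟨0, hr⟩
  obtain ⟨g0⟩ : Nonempty (Fin r ↪ Sym2 (Fin t)) :=
    Function.Embedding.nonempty_of_card_le (by simpa [Sym2.card] using hrt)
  let z : Fin t := ⟨0, ht⟩
  let g1 : Fin r → Sym2 (Fin t) := fun k => Equiv.swap (g0 k0) s(z, z) (g0 k)
  have hg1 : Function.Injective g1 := (Equiv.injective _).comp g0.injective
  have hg10 : g1 k0 = s(z, z) := by simp [g1]
  let g : Fin r → Sym2 ℕ := fun k => Sym2.map Fin.val (g1 k)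
  have hg : Function.Injective g := (Sym2.map.injective Fin.val_injective).comp hg1
  let c : Sym2 ℕ → Fin r := fun e => if h : ∃ k, g k = e then h.choose else k0
  have hc : ∀ k, c (g k) = k := by
    intro k
    have h : ∃ k', g k' = g k := ⟨k, rfl⟩
    have h1 : c (g k) = h.choose := dif_pos h
    rw [h1]
    exact hg h.choose_spec
  have hc' : ∀ k e, k ≠ k0 → c e = k → e = g k := by
    intro k e hk he
    by_cases h : ∃ k', g k' = e
    · have h1 : c e = h.choose := dif_pos h
      rw [← he, h1, h.choose_spec]
    · have h1 : c e = k0 := dif_neg h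
      exact absurd (he.symm.trans h1) hk
  let G : Fin r → SimpleGraph (Fin n) := fun k =>
    { Adj := fun u v => u ≠ v ∧ c s((u : ℕ) / s, (v : ℕ) / s) = k
      symm := by
        constructor
        rintro u v ⟨h1, h2⟩
        exact ⟨h1.symm, by rw [Sym2.eq_swap]; exact h2⟩
      loopless := by
        constructor
        rintro u ⟨h1, -⟩
        exact h1 rfl }
  have hG : ∀ k u v, (G k).Adj u v ↔ u ≠ v ∧ c s((u : ℕ) / s, (v : ℕ) / s) = k :=
    fun k u v => Iff.rfl
  refine ⟨G, ⟨?_, ?_⟩, ?_⟩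
  · intro i j hij
    rw [← SimpleGraph.disjoint_edgeSet, Set.disjoint_left]
    intro e
    induction e with
    | _ u v =>
      intro h1 h2
      rw [SimpleGraph.mem_edgeSet, hG] at h1 h2
      exact hij (h1.2.symm.trans h2.2)
  · ext u v
    rw [SimpleGraph.iSup_adj]
    simp only [hG, SimpleGraph.top_adj]
    exact ⟨fun ⟨k, h, _⟩ => h, fun h => ⟨_, h, rfl⟩⟩
  · intro k
    obtain ⟨i, j, hij⟩ : ∃ i j : Fin t, g1 k = s(i, j) := by
      generalize g1 k = e
      induction e with
      | _ i j => exact ⟨i, j, rfl⟩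
    have hgk : g k = s((i : ℕ), (j : ℕ)) := by simp [g, hij]
    by_cases hd : i = j
    · subst hd
      refine clique_all β hβ hs _ ⟨blk hn i i.2, blk_inj hn i i.2⟩ ?_
      intro a b hab
      rw [hG]
      refine ⟨fun h => hab (blk_inj hn i i.2 h), ?_⟩
      simp only [Function.Embedding.coeFn_mk, blk_div]
      rw [← hgk, hc]
    · have hk : k ≠ k0 := by
        rintro rfl
        rw [hg10, Sym2.eq_iff] at hij
        apply hd
        rcases hij with ⟨h1, h2⟩ | ⟨h1, h2⟩
        · rw [← h1, ← h2]
        · rw [← h1, ← h2]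
      have hd' : (i : ℕ) ≠ j := fun h => hd (Fin.ext h)
      have hex : ∀ u v, (G k).Adj u v → s((u : ℕ) / s, (v : ℕ) / s) = s((i : ℕ), (j : ℕ)) := by
        intro u v h
        rw [← hgk]
        exact hc' k _ hk h.2
      let f : Fin s ⊕ Fin s ↪ Fin n :=
        ⟨Sum.elim (blk hn i i.2) (blk hn j j.2), by
          apply Function.Injective.sumElim (blk_inj hn i i.2) (blk_inj hn j j.2)
          intro a b h
          have := congrArg (fun x : Fin n => (x : ℕ) / s) h
          simp only [blk_div] at this
          exact hd' this⟩
      have f1 : ∀ a, f (Sum.inl a) = blk hn i i.2 a := fun _ => rfl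
      have f2 : ∀ a, f (Sum.inr a) = blk hn j j.2 a := fun _ => rfl
      refine biclique_all β hβ hs _ f ?_ ?_ ?_ ?_
      · intro a b
        rw [hG]
        refine ⟨fun h => by simpa using f.injective h, ?_⟩
        rw [f1, f2, blk_div, blk_div, ← hgk, hc]
      · intro a b h
        have := hex _ _ h
        rw [f1, f1, blk_div, blk_div, Sym2.eq_iff] at this
        omega
      · intro a b h
        have := hex _ _ h
        rw [f2, f2, blk_div, blk_div, Sym2.eq_iff] at this
        omega
      · intro u v hu h
        have := hex _ _ h
        rw [Sym2.eq_iff] at this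
        apply hu
        rcases this with ⟨h1, -⟩ | ⟨h1, -⟩
        · obtain ⟨a, ha⟩ := blk_of (by omega) hn i i.2 u h1
          exact ⟨Sum.inl a, ha⟩
        · obtain ⟨a, ha⟩ := blk_of (by omega) hn j j.2 u h1
          exact ⟨Sum.inr a, ha⟩

lemma NG_bdd {n : ℕ} (β : SimpleGraph (Fin n) → ℕ) (r : ℕ) :
    BddAbove {s | ∃ G : Fin r → SimpleGraph (Fin n), IsDecomp G ∧ ∏ i, β (G i) = s} := by
  apply Set.Finite.bddAbove
  refine (Set.finite_range (fun G : Fin r → SimpleGraph (Fin n) => ∏ i, β (G i))).subset ?_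
  rintro _ ⟨G, -, rfl⟩
  exact ⟨G, rfl⟩

lemma NG_lower (β : (n : ℕ) → SimpleGraph (Fin n) → ℕ)
    (hβ : β = NG.xiParam ∨ β = NG.nuParam ∨ β = NG.muParam ∨ β = NG.hadwiger)
    (r t s n : ℕ) (hr : 0 < r) (hrt : r ≤ (t + 1).choose 2) (hs : 3 ≤ s) (hn : t * s ≤ n) :
    (s - 1) ^ r ≤ NGprodUp (β n) r := by
  obtain ⟨G, hG, h⟩ := exists_decomp β hβ r t s n hr hrt hs hn
  refine le_trans ?_ (le_csSup (NG_bdd (β n) r) ⟨G, hG, rfl⟩)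
  calc (s - 1) ^ r = ∏ _k : Fin r, (s - 1) := by simp
    _ ≤ _ := Finset.prod_le_prod' fun k _ => h k

lemma NG_upper (β : (n : ℕ) → SimpleGraph (Fin n) → ℕ)
    (hβ : β = NG.xiParam ∨ β = NG.nuParam ∨ β = NG.muParam ∨ β = NG.hadwiger)
    (r n : ℕ) (hr : 2 ≤ r) :
    (NGprodUp (β n) r : ℝ) ≤ Real.sqrt (((n : ℝ) ^ 2 + (2 * r + 1) * n) / r) ^ r := by
  unfold NGprodUp
  obtain ⟨N, hN⟩ := NG_bdd (β n) r
  refine sSup_prop _ N hN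
    (fun m => (m : ℝ) ≤ Real.sqrt (((n : ℝ) ^ 2 + (2 * r + 1) * n) / r) ^ r) ?_ ?_
  · simp only [Nat.cast_zero]; positivity
  · rintro _ ⟨G, hG, rfl⟩
    push_cast
    exact prod_le hr β hβ n G hG

lemma trt_spec (r : ℕ) : r ≤ (trt r + 1).choose 2 := by
  have h : Real.sqrt (2 * (r : ℝ) + 1 / 4) - 1 / 2 ≤ trt r := Nat.le_ceil _
  have h1 : Real.sqrt (2 * (r : ℝ) + 1 / 4) ≤ trt r + 1 / 2 := by linarith
  rw [Real.sqrt_le_left (by positivity)] at h1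
  have h2 : (r : ℝ) ≤ (((trt r + 1).choose 2 : ℕ) : ℝ) := by
    rw [Nat.cast_choose_two]
    push_cast
    nlinarith
  exact_mod_cast h2

open Filter Topology in
lemma main (r : ℕ) (hr : 2 ≤ r) (t : ℕ) (ht : t = NG.trt r)
    (β : (n : ℕ) → SimpleGraph (Fin n) → ℕ)
    (hβ : β = NG.xiParam ∨ β = NG.nuParam ∨ β = NG.muParam ∨ β = NG.hadwiger) :
    (((t : ℝ) ^ r)⁻¹ ≤
      Filter.liminf (fun n : ℕ => (NG.NGprodUp (β n) r : ℝ) / (n : ℝ) ^ r)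
        Filter.atTop) ∧
    Filter.limsup (fun n : ℕ => (NG.NGprodUp (β n) r : ℝ) / (n : ℝ) ^ r)
        Filter.atTop ≤ (Real.sqrt r ^ r)⁻¹ := by
  have hrt : r ≤ (t + 1).choose 2 := ht ▸ trt_spec r
  have ht0 : 0 < t := by
    rcases Nat.eq_zero_or_pos t with rfl | h
    · simp at hrt; omega
    · exact h
  have htR : (0 : ℝ) < t := by exact_mod_cast ht0
  have hrR : (0 : ℝ) < r := by exact_mod_cast (by omega : 0 < r)
  set F : ℕ → ℝ := fun n : ℕ => (NG.NGprodUp (β n) r : ℝ) / (n : ℝ) ^ r with hF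
  let lo : ℕ → ℝ := fun n => (1 / (t : ℝ) - 2 / n) ^ r
  let hi : ℕ → ℝ := fun n => Real.sqrt ((1 + (2 * r + 1) / n) / r) ^ r
  have hlo : Tendsto lo atTop (𝓝 (((t : ℝ) ^ r)⁻¹)) := by
    have : Tendsto (fun n : ℕ => (1 / (t : ℝ) - 2 / n) ^ r) atTop (𝓝 ((1 / (t : ℝ) - 0) ^ r)) :=
      (tendsto_const_nhds.sub (tendsto_const_div_atTop_nhds_zero_nat 2)).pow r
    have e : (1 / (t : ℝ) - 0) ^ r = ((t : ℝ) ^ r)⁻¹ := by simp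
    rw [e] at this
    exact this
  have hhi : Tendsto hi atTop (𝓝 ((Real.sqrt r ^ r)⁻¹)) := by
    have : Tendsto (fun n : ℕ => Real.sqrt ((1 + (2 * r + 1) / n) / r) ^ r) atTop
        (𝓝 (Real.sqrt ((1 + 0) / r) ^ r)) :=
      ((((tendsto_const_nhds.add
        (tendsto_const_div_atTop_nhds_zero_nat (2 * r + 1 : ℝ))).div_const _).sqrt).pow r)
    have e : Real.sqrt ((1 + 0) / r) ^ r = (Real.sqrt r ^ r)⁻¹ := by simp
    rw [e] at this
    exact this
  have hle : ∀ᶠ n in atTop, F n ≤ hi n := by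
    filter_upwards [eventually_gt_atTop 0] with n hn
    have hnR : (0 : ℝ) < n := by exact_mod_cast hn
    have h := NG_upper β hβ r n hr
    simp only [hF, hi]
    rw [div_le_iff₀ (by positivity), ← mul_pow]
    refine h.trans (le_of_eq ?_)
    congr 1
    have e : ((n : ℝ) ^ 2 + (2 * r + 1) * n) / r = ((1 + (2 * r + 1) / n) / r) * (n : ℝ) ^ 2 := by
      field_simp
    rw [e, Real.sqrt_mul (by positivity), Real.sqrt_sq hnR.le]
  have hge : ∀ᶠ n in atTop, lo n ≤ F n := by
    filter_upwards [eventually_ge_atTop (t * 3)] with n hn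
    have hn0 : 0 < n := by nlinarith
    have hnR : (0 : ℝ) < n := by exact_mod_cast hn0
    have hs : 3 ≤ n / t := by
      rw [Nat.le_div_iff_mul_le ht0]; linarith
    have h := NG_lower β hβ r t (n / t) n (by omega) hrt hs (Nat.mul_div_le n t)
    have h' : (((n / t : ℕ) : ℝ) - 1) ^ r ≤ (NGprodUp (β n) r : ℝ) := by
      have h2 : (((n / t - 1) ^ r : ℕ) : ℝ) ≤ (NGprodUp (β n) r : ℝ) := by exact_mod_cast h
      rw [Nat.cast_pow, Nat.cast_sub (by omega)] at h2
      simpa using h2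
    simp only [hF, lo]
    rw [le_div_iff₀ (by positivity), ← mul_pow]
    refine le_trans ?_ h'
    have h3 : (n : ℝ) / t < ((n / t : ℕ) : ℝ) + 1 := by
      have := Nat.lt_div_mul_add (a := n) ht0
      have h4 : (n : ℝ) < ((n / t : ℕ) : ℝ) * t + t := by exact_mod_cast this
      rw [div_lt_iff₀ htR]; linarith
    have h5 : (1 / (t : ℝ) - 2 / n) * n = n / t - 2 := by field_simp
    have h6 : (3 : ℝ) ≤ n / t := by
      rw [le_div_iff₀ htR]
      have : ((t * 3 : ℕ) : ℝ) ≤ n := by exact_mod_cast hn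
      push_cast at this; linarith
    rw [h5]
    exact pow_le_pow_left₀ (by linarith) (by linarith) r
  have hb1 : IsBoundedUnder (· ≤ ·) atTop F := hhi.isBoundedUnder_le.mono_le hle
  have hb2 : IsBoundedUnder (· ≥ ·) atTop F := hlo.isBoundedUnder_ge.mono_ge hge
  constructor
  · rw [← hlo.liminf_eq]
    exact liminf_le_liminf hge hlo.isBoundedUnder_ge hb1.isCoboundedUnder_ge
  · rw [← hhi.limsup_eq]
    exact limsup_le_limsup hle hb2.isCoboundedUnder_le hhi.isBoundedUnder_le

end NG

/-- For `β ∈ {ξ, ν, μ, η}`, fixed `r ≥ 2` and `t = ⌈√(2r+1/4) − 1/2⌉`: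
`liminf_{n→∞} NGΠ↑_β(r;n)/nʳ ≥ t⁻ʳ` and
`limsup_{n→∞} NGΠ↑_β(r;n)/nʳ ≤ r^(−r/2) = (√r ^ r)⁻¹`. -/
theorem statement13 (r : ℕ) (hr : 2 ≤ r) (t : ℕ) (ht : t = NG.trt r)
    (β : (n : ℕ) → SimpleGraph (Fin n) → ℕ)
    (hβ : β = NG.xiParam ∨ β = NG.nuParam ∨ β = NG.muParam ∨ β = NG.hadwiger) :
    (((t : ℝ) ^ r)⁻¹ ≤
      Filter.liminf (fun n : ℕ => (NG.NGprodUp (β n) r : ℝ) / (n : ℝ) ^ r)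
        Filter.atTop) ∧
    Filter.limsup (fun n : ℕ => (NG.NGprodUp (β n) r : ℝ) / (n : ℝ) ^ r)
        Filter.atTop ≤ (Real.sqrt r ^ r)⁻¹ := by
  exact NG.main r hr t ht β hβ
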